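/- Let ν ≥ 0, let u, u′ : ℝ×ℝ³ → ℝ³, p : ℝ×ℝ³ → ℝ and f : ℝ×ℝ³ → ℝ³ be smooth and periodic in space, and let τ : ℝ×ℝ³ → ℝ be smooth, periodic in space and strictly positive. Assume that for every time t: (i) the dynamic small-scale equation ∂ₜu′ + τ⁻¹u′ + r = 0 holds pointwise, where r := ∂ₜu + ((u+u′)·∇)u + ∇p − νΔu − f; (ii) the skew-symmetric (Stokes-projected) large-scale equation tested with (w,q) = (u,p) holds, i.e. ∫_T [ u·∂ₜu + u·∂ₜu′ − (((u+u′)·∇)u)·u′ + 2ν ∇ˢu:∇u ] dx = ∫_T u·f dx. Then the total kinetic energy E(t) := ½∫_T |u+u′|² dx satisfies, for every t, dE/dt = −2ν∫_T |∇ˢu|² dx − ∫_T τ⁻¹|u′|² dx + ∫_T (u+u′)·f dx + ν∫_T Δu·u′ dx − ∫_T ∇p·u′ dx. -/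

import Mathlib

open MeasureTheory Real

noncomputable section

/-- The periodicity cube `[0, 2π]³ ⊂ ℝ³`. -/
def Tcube : Set (Fin 3 → ℝ) := Set.Icc 0 (fun _ => 2 * Real.pi)

/-- Partial derivative of a scalar field on `ℝ³` in coordinate direction `j`. -/
def pd (f : (Fin 3 → ℝ) → ℝ) (j : Fin 3) (x : Fin 3 → ℝ) : ℝ :=
  fderiv ℝ f x (Pi.single j 1)

/-- `2π`-periodicity in each of the three coordinates. -/
def SpacePeriodic {α : Type*} (f : (Fin 3 → ℝ) → α) : Prop :=
  ∀ (x : Fin 3 → ℝ) (j : Fin 3), f (x + Pi.single j (2 * Real.pi)) = f x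

/-- Time derivative `∂ₜuᵢ` of the `i`-th component of a time-dependent vector field. -/
def dt (u : ℝ × (Fin 3 → ℝ) → (Fin 3 → ℝ)) (i : Fin 3) (t : ℝ) (x : Fin 3 → ℝ) : ℝ :=
  deriv (fun s => u (s, x) i) t

/-- Spatial partial derivative `∂ⱼuᵢ` of a time-dependent vector field. -/
def dx (u : ℝ × (Fin 3 → ℝ) → (Fin 3 → ℝ)) (i j : Fin 3) (t : ℝ) (x : Fin 3 → ℝ) : ℝ :=
  pd (fun y => u (t, y) i) j x

/-- Spatial partial derivative `∂ⱼp` of a time-dependent scalar field. -/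
def dxS (p : ℝ × (Fin 3 → ℝ) → ℝ) (j : Fin 3) (t : ℝ) (x : Fin 3 → ℝ) : ℝ :=
  pd (fun y => p (t, y)) j x

/-- Componentwise Laplacian `Δuᵢ` of a time-dependent vector field. -/
def lap (u : ℝ × (Fin 3 → ℝ) → (Fin 3 → ℝ)) (i : Fin 3) (t : ℝ) (x : Fin 3 → ℝ) : ℝ :=
  ∑ j, pd (fun y => dx u i j t y) j x

lemma isCompact_Tcube : IsCompact Tcube := isCompact_Icc

lemma integrableOn_Tcube {g : (Fin 3 → ℝ) → ℝ} (hg : Continuous g) :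
    IntegrableOn g Tcube :=
  hg.continuousOn.integrableOn_compact isCompact_Tcube

lemma ContDiff.pd {g : (Fin 3 → ℝ) → ℝ} (hg : ContDiff ℝ (⊤ : ℕ∞) g) (j : Fin 3) :
    ContDiff ℝ (⊤ : ℕ∞) (pd g j) :=
  (hg.fderiv_right (m := (⊤ : ℕ∞)) (by simp)).clm_apply contDiff_const

section SmoothField

variable {u : ℝ × (Fin 3 → ℝ) → (Fin 3 → ℝ)}

lemma contDiff_slice_apply (hu : ContDiff ℝ (⊤ : ℕ∞) u) (i : Fin 3) (t : ℝ) :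
    ContDiff ℝ (⊤ : ℕ∞) fun x => u (t, x) i :=
  contDiff_pi.1 (hu.comp (contDiff_prodMk_right t)) i

lemma contDiff_dx (hu : ContDiff ℝ (⊤ : ℕ∞) u) (i j : Fin 3) (t : ℝ) :
    ContDiff ℝ (⊤ : ℕ∞) (dx u i j t) :=
  (contDiff_slice_apply hu i t).pd j

lemma continuous_lap (hu : ContDiff ℝ (⊤ : ℕ∞) u) (i : Fin 3) (t : ℝ) :
    Continuous (lap u i t) :=
  continuous_finsetSum _ fun j _ => ((contDiff_dx hu i j t).pd j).continuous

lemma hasDerivAt_time_slice (hu : ContDiff ℝ (⊤ : ℕ∞) u) (i : Fin 3) (t : ℝ) (x : Fin 3 → ℝ) :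
    HasDerivAt (fun s => u (s, x) i) (dt u i t x) t := by
  have h : ContDiff ℝ (⊤ : ℕ∞) fun s => u (s, x) i :=
    contDiff_pi.1 (hu.comp (contDiff_prodMk_left x)) i
  exact (h.differentiable (by simp)).differentiableAt.hasDerivAt

lemma continuous_dt (hu : ContDiff ℝ (⊤ : ℕ∞) u) (i : Fin 3) :
    Continuous fun z : ℝ × (Fin 3 → ℝ) => dt u i z.1 z.2 := by
  have hui : ContDiff ℝ (⊤ : ℕ∞) fun z => u z i := contDiff_pi.1 hu i
  have h : ∀ z : ℝ × (Fin 3 → ℝ),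
      dt u i z.1 z.2 = fderiv ℝ (fun z => u z i) z (1, 0) := fun z =>
    ((hui.differentiable (by simp)).differentiableAt.hasFDerivAt.comp_hasDerivAt z.1
      ((hasDerivAt_id z.1).prodMk (hasDerivAt_const z.1 z.2))).deriv
  simp_rw [h]
  exact (hui.continuous_fderiv (by simp)).clm_apply continuous_const

end SmoothField

lemma hasDerivAt_setIntegral_of_continuous {E : Type*} [TopologicalSpace E]
    [MeasurableSpace E] [OpensMeasurableSpace E] [T2Space E]
    {μ : Measure E} [IsFiniteMeasureOnCompacts μ]
    {K : Set E} (hK : IsCompact K) {F F' : ℝ → E → ℝ}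
    (hF : ∀ s, Continuous (F s)) (hF' : Continuous fun z : ℝ × E => F' z.1 z.2)
    (hd : ∀ s x, HasDerivAt (fun r => F r x) (F' s x) s) (t : ℝ) :
    HasDerivAt (fun s => ∫ x in K, F s x ∂μ) (∫ x in K, F' t x ∂μ) t := by
  obtain ⟨C, hC⟩ := ((isCompact_closedBall t 1).prod hK).exists_bound_of_continuousOn
    hF'.continuousOn
  have hsm : ∀ g : E → ℝ, Continuous g → IntegrableOn g K μ :=
    fun g hg => hg.continuousOn.integrableOn_compact hK
  refine (hasDerivAt_integral_of_dominated_loc_of_deriv_le (bound := fun _ => C)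
    (Metric.closedBall_mem_nhds t one_pos)
    (Filter.Eventually.of_forall fun s => (hsm _ (hF s)).aestronglyMeasurable)
    (hsm _ (hF t))
    (hsm _ (hF'.comp (Continuous.prodMk_right t))).aestronglyMeasurable
    ?_ (hsm _ continuous_const) ?_).2
  · filter_upwards [ae_restrict_mem hK.measurableSet] with x hx s hs
    exact hC (s, x) ⟨hs, hx⟩
  · exact Filter.Eventually.of_forall fun x s _ => hd s x

lemma sum_symmGrad_mul_grad {n : Type*} [Fintype n] (a : n → n → ℝ) :
    ∑ i, ∑ j, ((1/2) * (a i j + a j i)) * a i j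
      = ∑ i, ∑ j, ((1/2) * (a i j + a j i))^2 := by
  have h : ∑ i, ∑ j, ((1/2) * (a i j + a j i)) * a i j
      = ∑ i, ∑ j, ((1/2) * (a i j + a j i)) * a j i := by
    rw [Finset.sum_comm]
    simp_rw [add_comm]
  calc _ = (1/2) * (∑ i, ∑ j, ((1/2) * (a i j + a j i)) * a i j
        + ∑ i, ∑ j, ((1/2) * (a i j + a j i)) * a j i) := by rw [← h]; ring
    _ = _ := by
      simp_rw [← Finset.sum_add_distrib, Finset.mul_sum]
      exact Finset.sum_congr rfl fun i _ => Finset.sum_congr rfl fun j _ => by ring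

/-- Energy evolution of the skew-symmetric, Stokes-projected VMS formulation with
dynamic small-scales, formula (32) of the paper. -/
theorem vmsds_energy_evolution
    (ν : ℝ) (hν : 0 ≤ ν)
    (u u' f : ℝ × (Fin 3 → ℝ) → (Fin 3 → ℝ))
    (p τ : ℝ × (Fin 3 → ℝ) → ℝ)
    (hu : ContDiff ℝ (⊤ : ℕ∞) u) (hu' : ContDiff ℝ (⊤ : ℕ∞) u')
    (hf : ContDiff ℝ (⊤ : ℕ∞) f) (hp : ContDiff ℝ (⊤ : ℕ∞) p)
    (hτ : ContDiff ℝ (⊤ : ℕ∞) τ)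
    (hup : ∀ t, SpacePeriodic fun x => u (t, x))
    (hu'p : ∀ t, SpacePeriodic fun x => u' (t, x))
    (hfp : ∀ t, SpacePeriodic fun x => f (t, x))
    (hpp : ∀ t, SpacePeriodic fun x => p (t, x))
    (hτp : ∀ t, SpacePeriodic fun x => τ (t, x))
    (hτpos : ∀ t x, 0 < τ (t, x))
    -- (i) dynamic small-scale equation ∂ₜu′ + τ⁻¹u′ + r = 0
    (hsmall : ∀ t x i,
      dt u' i t x + (τ (t, x))⁻¹ * u' (t, x) i
        + (dt u i t x + (∑ j, (u (t, x) j + u' (t, x) j) * dx u i j t x)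
            + dxS p i t x - ν * lap u i t x - f (t, x) i) = 0)
    -- (ii) the skew-symmetric large-scale equation tested with (w, q) = (u, p)
    (hlarge : ∀ t,
      (∫ x in Tcube,
        ((∑ i, u (t, x) i * dt u i t x)
          + (∑ i, u (t, x) i * dt u' i t x)
          - (∑ i, (∑ j, (u (t, x) j + u' (t, x) j) * dx u i j t x) * u' (t, x) i)
          + 2 * ν * (∑ i, ∑ j, ((1/2) * (dx u i j t x + dx u j i t x)) * dx u i j t x)))
      = ∫ x in Tcube, ∑ i, u (t, x) i * f (t, x) i) :
    ∀ t, HasDerivAt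
      (fun s => (1/2) * ∫ x in Tcube, ∑ i, (u (s, x) i + u' (s, x) i)^2)
      (- (2 * ν * ∫ x in Tcube,
            ∑ i, ∑ j, ((1/2) * (dx u i j t x + dx u j i t x))^2)
        - (∫ x in Tcube, (τ (t, x))⁻¹ * ∑ i, (u' (t, x) i)^2)
        + (∫ x in Tcube, ∑ i, (u (t, x) i + u' (t, x) i) * f (t, x) i)
        + ν * (∫ x in Tcube, ∑ i, lap u i t x * u' (t, x) i)
        - (∫ x in Tcube, ∑ i, dxS p i t x * u' (t, x) i)) t := by
  intro t
  have cu := hu.continuous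
  have cu' := hu'.continuous
  have cf := hf.continuous
  have cdx : ∀ i j, Continuous fun x => dx u i j t x := fun i j => (contDiff_dx hu i j t).continuous
  have clap : ∀ i, Continuous fun x => lap u i t x := fun i => continuous_lap hu i t
  have cp : ∀ i, Continuous fun x => dxS p i t x :=
    fun i => ((hp.comp (contDiff_prodMk_right t)).pd i).continuous
  have cdt : ∀ i, Continuous fun x => dt u i t x :=
    fun i => (continuous_dt hu i).comp (Continuous.prodMk_right t)
  have cdt' : ∀ i, Continuous fun x => dt u' i t x :=
    fun i => (continuous_dt hu' i).comp (Continuous.prodMk_right t)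
  obtain ⟨σ, hσ⟩ : ∃ σ : (Fin 3 → ℝ) → ℝ, ∀ x, (τ (t, x))⁻¹ = σ x := ⟨_, fun _ => rfl⟩
  have cσ : Continuous σ := by
    rw [← funext hσ]
    exact (hτ.continuous.comp (Continuous.prodMk_right t)).inv₀ fun x => (hτpos t x).ne'
  simp_rw [hσ]
  have hE := (hasDerivAt_setIntegral_of_continuous (μ := volume) isCompact_Tcube
    (F := fun s x => ∑ i, (u (s, x) i + u' (s, x) i)^2)
    (F' := fun s x => ∑ i, 2 * ((u (s, x) i + u' (s, x) i) * (dt u i s x + dt u' i s x)))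
    (fun s => continuous_finsetSum _ fun i _ => ((contDiff_slice_apply hu i s).continuous.add
      (contDiff_slice_apply hu' i s).continuous).pow 2)
    (by
      have h3 := continuous_dt hu
      have h4 := continuous_dt hu'
      fun_prop)
    (fun s x => HasDerivAt.fun_sum fun i _ => by
      have h := ((hasDerivAt_time_slice hu i s x).fun_add
        (hasDerivAt_time_slice hu' i s x)).fun_pow 2
      exact h.congr_deriv (by push_cast; ring))
    t).const_mul (1/2)
  refine hE.congr_deriv ?_
  have hL := hlarge t
  rw [← sub_eq_zero, ← integral_sub (integrableOn_Tcube (by fun_prop))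
    (integrableOn_Tcube (by fun_prop))] at hL
  rw [← add_zero (1 / 2 * _), ← neg_zero, ← hL]
  simp_rw [← integral_const_mul]
  rw [← integral_neg, ← integral_neg,
    ← integral_add (integrableOn_Tcube (by fun_prop)) (integrableOn_Tcube (by fun_prop)),
    ← integral_sub (integrableOn_Tcube (by fun_prop)) (integrableOn_Tcube (by fun_prop)),
    ← integral_add (integrableOn_Tcube (by fun_prop)) (integrableOn_Tcube (by fun_prop)),
    ← integral_add (integrableOn_Tcube (by fun_prop)) (integrableOn_Tcube (by fun_prop)),
    ← integral_sub (integrableOn_Tcube (by fun_prop)) (integrableOn_Tcube (by fun_prop))]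
  congr 1
  funext x
  rw [sum_symmGrad_mul_grad fun i j => dx u i j t x]
  have key : ∀ i, u' (t, x) i * (dt u' i t x + σ x * u' (t, x) i
        + (dt u i t x + (∑ j, (u (t, x) j + u' (t, x) j) * dx u i j t x)
            + dxS p i t x - ν * lap u i t x - f (t, x) i)) = 0 := fun i => by
    rw [← hσ x, hsmall t x i, mul_zero]
  generalize (∑ i, ∑ j, ((1/2) * (dx u i j t x + dx u j i t x))^2) = D
  generalize hc : (fun i => ∑ j, (u (t, x) j + u' (t, x) j) * dx u i j t x) = c
  have hc' : ∀ i, ∑ j, (u (t, x) j + u' (t, x) j) * dx u i j t x = c i := congrFun hc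
  simp only [hc'] at key ⊢
  simp only [Fin.sum_univ_three]
  linear_combination key 0 + key 1 + key 2
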